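/- Let Z be a compact metrizable space with compatible metric ρ, let G be a countable sofic group with sofic approximation sequence Σ, and consider the left shift action of G on X = Z^G. Define ρ'(x,y) = ρ(x_{e_G}, y_{e_G}) for x,y ∈ X. Then ρ' is a dynamically generating continuous pseudometric on X, and for every ε > 0 one has log N_ε(Z,ρ) ≤ h^ε_{Σ,∞}(ρ') ≤ log N_{ε/2}(Z,ρ). In particular mdim_{Σ,M}(X,ρ') equals the lower box dimension of (Z,ρ), namely liminf_{ε→0} log N_ε(Z,ρ)/|log ε|. -/

import Mathlib

open Filter Topology TopologicalSpace
open scoped ENat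
open scoped Classical Pointwise

namespace SoficMD

/-- A sofic approximation sequence for a group `G`. -/
structure SoficApprox (G : Type*) [Group G] where
  d : ℕ → ℕ
  σ : ∀ i, G → Equiv.Perm (Fin (d i))
  approx_mul : ∀ s t : G, Tendsto
    (fun i => ((Finset.univ.filter fun a : Fin (d i) => σ i s (σ i t a) = σ i (s * t) a).card : ℝ) / (d i : ℝ))
    atTop (𝓝 1)
  approx_sep : ∀ s t : G, s ≠ t → Tendsto
    (fun i => ((Finset.univ.filter fun a : Fin (d i) => σ i s a = σ i t a).card : ℝ) / (d i : ℝ))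
    atTop (𝓝 0)
  d_tendsto : Tendsto d atTop atTop

/-- A continuous pseudometric on a topological space. -/
structure ContPseudoMetric (X : Type*) [TopologicalSpace X] where
  d : X → X → ℝ
  continuous' : Continuous fun p : X × X => d p.1 p.2
  nonneg : ∀ x y, 0 ≤ d x y
  symm : ∀ x y, d x y = d y x
  refl : ∀ x, d x x = 0
  triangle : ∀ x y z, d x z ≤ d x y + d y z

/-- A continuous pseudometric on a compact Hausdorff space is a compatible metric iff it
separates points. -/
def ContPseudoMetric.IsCompatMetric {X : Type*} [TopologicalSpace X]
    (ρ : ContPseudoMetric X) : Prop :=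
  ∀ x y : X, ρ.d x y = 0 → x = y

/-- A continuous pseudometric is dynamically generating if translates separate points. -/
def DynGenerating (G : Type*) {X : Type*} [Group G] [TopologicalSpace X] [MulAction G X]
    (ρ : ContPseudoMetric X) : Prop :=
  ∀ x y : X, x ≠ y → ∃ s : G, 0 < ρ.d (s • x) (s • y)

/-- Equivariance of a map between two `G`-spaces. -/
def Equivariant (G : Type*) {A B : Type*} [SMul G A] [SMul G B] (f : A → B) : Prop :=
  ∀ (s : G) (a : A), f (s • a) = s • f a

/-- The normalized ℓ² pseudometric on maps `[d] → X`. -/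
noncomputable def rho2 {X : Type*} [TopologicalSpace X] (ρ : ContPseudoMetric X) {d : ℕ}
    (φ ψ : Fin d → X) : ℝ :=
  Real.sqrt ((1 / (d : ℝ)) * ∑ a, (ρ.d (φ a) (ψ a)) ^ 2)

/-- The ℓ^∞ pseudometric on maps `[d] → X`. -/
noncomputable def rhoInfty {X : Type*} [TopologicalSpace X] (ρ : ContPseudoMetric X) {d : ℕ}
    (φ ψ : Fin d → X) : ℝ :=
  ⨆ a : Fin d, ρ.d (φ a) (ψ a)

/-- The space of `(ρ, F, δ)`-approximately equivariant maps `[d] → X` relative to `σ`. -/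
def MapSpace {G X : Type*} [Group G] [TopologicalSpace X] [MulAction G X]
    (ρ : ContPseudoMetric X) (F : Finset G) (δ : ℝ) {d : ℕ}
    (σ : G → Equiv.Perm (Fin d)) : Set (Fin d → X) :=
  {φ | ∀ s ∈ F, rho2 ρ (fun a => φ (σ s a)) (fun a => s • φ a) ≤ δ}

/-- A finite open cover. -/
def IsFinOpenCover {Y : Type*} [TopologicalSpace Y] (𝒰 : Finset (Set Y)) : Prop :=
  (∀ U ∈ 𝒰, IsOpen U) ∧ (⋃ U ∈ 𝒰, U) = Set.univ

/-- `𝒱` refines `𝒰`. -/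
def Refines {Y : Type*} (𝒱 𝒰 : Finset (Set Y)) : Prop :=
  ∀ V ∈ 𝒱, ∃ U ∈ 𝒰, V ⊆ U

/-- `ord` of a finite family of sets: the maximal multiplicity minus one. -/
noncomputable def coverOrd {Y : Type*} (𝒰 : Finset (Set Y)) : EReal :=
  (⨆ y : Y, (((𝒰.filter fun U => y ∈ U).card : ℝ) : EReal)) - 1

/-- `D(𝒰)`: the infimum of `ord 𝒱` over finite open covers `𝒱` refining `𝒰`. -/
noncomputable def coverD {Y : Type*} [TopologicalSpace Y] (𝒰 : Finset (Set Y)) : EReal :=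
  ⨅ 𝒱 ∈ {𝒱 : Finset (Set Y) | IsFinOpenCover 𝒱 ∧ Refines 𝒱 𝒰}, coverOrd 𝒱

/-- the product cover `𝒰^d` of `Y^[d]`. -/
noncomputable def prodCover {Y : Type*} (𝒰 : Finset (Set Y)) (d : ℕ) :
    Finset (Set (Fin d → Y)) :=
  (Fintype.piFinset fun _ : Fin d => 𝒰).image fun U => {φ | ∀ a, φ a ∈ U a}

/-- restriction of a cover to a subset, viewed as a cover of the subtype. -/
noncomputable def restrictCover {Y : Type*} (𝒰 : Finset (Set Y)) (Z : Set Y) :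
    Finset (Set Z) :=
  𝒰.image fun U => (Subtype.val ⁻¹' U : Set Z)

/-- `D(𝒰, ρ, F, δ, σ)`. -/
noncomputable def coverDMap {G X : Type*} [Group G] [TopologicalSpace X] [MulAction G X]
    (𝒰 : Finset (Set X)) (ρ : ContPseudoMetric X) (F : Finset G) (δ : ℝ) {d : ℕ}
    (σ : G → Equiv.Perm (Fin d)) : EReal :=
  coverD (restrictCover (prodCover 𝒰 d) (MapSpace ρ F δ σ))

/-- `D_Σ(𝒰, ρ, F, δ)`. -/
noncomputable def DSigmaFdel {G X : Type*} [Group G] [TopologicalSpace X] [MulAction G X]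
    (Sap : SoficApprox G) (𝒰 : Finset (Set X)) (ρ : ContPseudoMetric X)
    (F : Finset G) (δ : ℝ) : EReal :=
  limsup (fun i => coverDMap 𝒰 ρ F δ (Sap.σ i) * ((Sap.d i : ℝ)⁻¹ : EReal)) atTop

/-- `D_Σ(𝒰, ρ, F)`. -/
noncomputable def DSigmaF {G X : Type*} [Group G] [TopologicalSpace X] [MulAction G X]
    (Sap : SoficApprox G) (𝒰 : Finset (Set X)) (ρ : ContPseudoMetric X)
    (F : Finset G) : EReal :=
  ⨅ δ : {δ : ℝ // 0 < δ}, DSigmaFdel Sap 𝒰 ρ F δ.1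

/-- `D_Σ(𝒰, ρ)`. -/
noncomputable def DSigmaU {G X : Type*} [Group G] [TopologicalSpace X] [MulAction G X]
    (Sap : SoficApprox G) (𝒰 : Finset (Set X)) (ρ : ContPseudoMetric X) : EReal :=
  ⨅ F : {F : Finset G // F.Nonempty}, DSigmaF Sap 𝒰 ρ F.1

/-- the sofic mean topological dimension `mdim_Σ(X, ρ)`. -/
noncomputable def mdimSigma {G X : Type*} [Group G] [TopologicalSpace X] [MulAction G X]
    (Sap : SoficApprox G) (ρ : ContPseudoMetric X) : EReal :=
  ⨆ 𝒰 ∈ {𝒰 : Finset (Set X) | IsFinOpenCover 𝒰}, DSigmaU Sap 𝒰 ρ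

/-- `N_ε(Y, ρ)`: the maximal cardinality of `ε`-separated subsets. -/
noncomputable def sepNum {Y : Type*} (ρ : Y → Y → ℝ) (ε : ℝ) : ℕ∞ :=
  ⨆ E ∈ {E : Set Y | ∀ x ∈ E, ∀ y ∈ E, x ≠ y → ε ≤ ρ x y}, E.encard

/-- The extended-real logarithm of an extended natural number. -/
noncomputable def elog (n : ℕ∞) : EReal :=
  if n = ⊤ then ⊤ else if n = 0 then ⊥ else ((Real.log n.toNat : ℝ) : EReal)

/-- `log N_ε(Map(ρ,F,δ,σ), ρ_∞)`. -/
noncomputable def hCnt {G X : Type*} [Group G] [TopologicalSpace X] [MulAction G X]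
    (ρ : ContPseudoMetric X) (F : Finset G) (δ : ℝ) {d : ℕ}
    (σ : G → Equiv.Perm (Fin d)) (ε : ℝ) : EReal :=
  elog (sepNum (fun φ ψ : MapSpace ρ F δ σ => rhoInfty ρ φ.1 ψ.1) ε)

/-- `h^ε_{Σ,∞}(ρ, F, δ)`. -/
noncomputable def hEpsFdel {G X : Type*} [Group G] [TopologicalSpace X] [MulAction G X]
    (Sap : SoficApprox G) (ρ : ContPseudoMetric X) (ε : ℝ) (F : Finset G) (δ : ℝ) : EReal :=
  limsup (fun i => hCnt ρ F δ (Sap.σ i) ε * ((Sap.d i : ℝ)⁻¹ : EReal)) atTop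

/-- `h^ε_{Σ,∞}(ρ)`. -/
noncomputable def hEps {G X : Type*} [Group G] [TopologicalSpace X] [MulAction G X]
    (Sap : SoficApprox G) (ρ : ContPseudoMetric X) (ε : ℝ) : EReal :=
  ⨅ F : {F : Finset G // F.Nonempty}, ⨅ δ : {δ : ℝ // 0 < δ}, hEpsFdel Sap ρ ε F.1 δ.1

/-- The sofic mean metric dimension `mdim_{Σ,M}(X, ρ)`. -/
noncomputable def mdimSigmaM {G X : Type*} [Group G] [TopologicalSpace X] [MulAction G X]
    (Sap : SoficApprox G) (ρ : ContPseudoMetric X) : EReal :=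
  liminf (fun ε : ℝ => hEps Sap ρ ε * ((|Real.log ε|⁻¹ : ℝ) : EReal)) (𝓝[>] (0 : ℝ))

/-- The sofic mean metric dimension `mdim_{Σ,M}(X)`. -/
noncomputable def mdimSigmaMFull {G : Type*} [Group G] (Sap : SoficApprox G)
    (X : Type*) [TopologicalSpace X] [MulAction G X] : EReal :=
  ⨅ ρ : {ρ : ContPseudoMetric X // ρ.IsCompatMetric}, mdimSigmaM Sap ρ.1

/-- Følner-type characterization of amenability of a discrete group. -/
def AmenableF (G : Type*) [Group G] : Prop :=
  ∀ (K : Finset G) (ε : ℝ), 0 < ε →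
    ∃ F : Finset G, F.Nonempty ∧ (((K * F) \ F).card : ℝ) < ε * F.card

/-- The set of `(K, ε)`-invariant nonempty finite subsets of `G`. -/
noncomputable def FolnerSets {G : Type*} [Group G] (K : Finset G) (ε : ℝ) :
    Set (Finset G) :=
  {F | F.Nonempty ∧ (((K * F) \ F).card : ℝ) < ε * F.card}

/-- The cover `𝒰^F = ⋁_{s ∈ F} s⁻¹ 𝒰`. -/
noncomputable def coverJoin {G X : Type*} [Group G] [TopologicalSpace X] [MulAction G X]
    (𝒰 : Finset (Set X)) (F : Finset G) : Finset (Set X) :=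
  (F.pi fun _ => 𝒰).image fun f => ⋂ s, ⋂ (h : s ∈ F), (fun x : X => s • x) ⁻¹' f s h

/-- `mdim(𝒰)` as an inf-sup over more and more invariant sets. -/
noncomputable def mdimCoverIS {G X : Type*} [Group G] [TopologicalSpace X] [MulAction G X]
    (𝒰 : Finset (Set X)) : EReal :=
  ⨅ K : Finset G, ⨅ ε : {ε : ℝ // 0 < ε},
    ⨆ F ∈ FolnerSets K ε.1, coverD (coverJoin 𝒰 F) * ((F.card : ℝ)⁻¹ : EReal)

/-- `mdim(𝒰)` as a sup-inf over more and more invariant sets. -/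
noncomputable def mdimCoverSI {G X : Type*} [Group G] [TopologicalSpace X] [MulAction G X]
    (𝒰 : Finset (Set X)) : EReal :=
  ⨆ K : Finset G, ⨆ ε : {ε : ℝ // 0 < ε},
    ⨅ F ∈ FolnerSets K ε.1, coverD (coverJoin 𝒰 F) * ((F.card : ℝ)⁻¹ : EReal)

/-- mean topological dimension, inf-sup form. -/
noncomputable def mdimIS (G X : Type*) [Group G] [TopologicalSpace X] [MulAction G X] :
    EReal :=
  ⨆ 𝒰 ∈ {𝒰 : Finset (Set X) | IsFinOpenCover 𝒰}, mdimCoverIS (G := G) 𝒰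

/-- mean topological dimension, sup-inf form. -/
noncomputable def mdimSI (G X : Type*) [Group G] [TopologicalSpace X] [MulAction G X] :
    EReal :=
  ⨆ 𝒰 ∈ {𝒰 : Finset (Set X) | IsFinOpenCover 𝒰}, mdimCoverSI (G := G) 𝒰

/-- the pseudometric `ρ_F(x,y) = max_{s ∈ F} ρ(sx, sy)`. -/
noncomputable def rhoF {G X : Type*} [Group G] [TopologicalSpace X] [MulAction G X]
    (ρ : ContPseudoMetric X) (F : Finset G) (x y : X) : ℝ :=
  ⨆ s : F, ρ.d ((s : G) • x) ((s : G) • y)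

/-- diameter of a set w.r.t. a pseudometric given as a function. -/
noncomputable def diamP {Y : Type*} (ρ : Y → Y → ℝ) (U : Set Y) : ℝ :=
  ⨆ x : U, ⨆ y : U, ρ x y

/-- mesh of a finite cover w.r.t. a pseudometric given as a function. -/
noncomputable def meshP {Y : Type*} (ρ : Y → Y → ℝ) (𝒰 : Finset (Set Y)) : ℝ :=
  ⨆ U : 𝒰, diamP ρ U.1

/-- minimal cardinality of a finite open cover of mesh `< ε`. -/
noncomputable def minCoverCard {Y : Type*} [TopologicalSpace Y] (ρ : Y → Y → ℝ) (ε : ℝ) : ℕ :=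
  sInf {n : ℕ | ∃ 𝒰 : Finset (Set Y), IsFinOpenCover 𝒰 ∧ meshP ρ 𝒰 < ε ∧ 𝒰.card = n}

/-- `S(X, ε, ρ)` in inf-sup form. -/
noncomputable def SamenIS {G X : Type*} [Group G] [TopologicalSpace X] [MulAction G X]
    (ρ : ContPseudoMetric X) (ε : ℝ) : EReal :=
  ⨅ K : Finset G, ⨅ δ : {δ : ℝ // 0 < δ},
    ⨆ F ∈ FolnerSets K δ.1,
      ((Real.log (minCoverCard (rhoF ρ F) ε) / F.card : ℝ) : EReal)

/-- `S(X, ε, ρ)` in sup-inf form. -/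
noncomputable def SamenSI {G X : Type*} [Group G] [TopologicalSpace X] [MulAction G X]
    (ρ : ContPseudoMetric X) (ε : ℝ) : EReal :=
  ⨆ K : Finset G, ⨆ δ : {δ : ℝ // 0 < δ},
    ⨅ F ∈ FolnerSets K δ.1,
      ((Real.log (minCoverCard (rhoF ρ F) ε) / F.card : ℝ) : EReal)

/-- mean metric dimension `mdim_M(X, ρ)`, inf-sup form. -/
noncomputable def mdimMIS {G X : Type*} [Group G] [TopologicalSpace X] [MulAction G X]
    (ρ : ContPseudoMetric X) : EReal :=
  liminf (fun ε : ℝ => SamenIS (G := G) ρ ε * ((|Real.log ε|⁻¹ : ℝ) : EReal)) (𝓝[>] (0 : ℝ))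

/-- mean metric dimension `mdim_M(X, ρ)`, sup-inf form. -/
noncomputable def mdimMSI {G X : Type*} [Group G] [TopologicalSpace X] [MulAction G X]
    (ρ : ContPseudoMetric X) : EReal :=
  liminf (fun ε : ℝ => SamenSI (G := G) ρ ε * ((|Real.log ε|⁻¹ : ℝ) : EReal)) (𝓝[>] (0 : ℝ))

/-- The covering dimension of a topological space, as an extended natural number. -/
noncomputable def covDim (Y : Type*) [TopologicalSpace Y] : ℕ∞ :=
  sInf {n : ℕ∞ | ∀ 𝒰 : Finset (Set Y), IsFinOpenCover 𝒰 →
    ∃ 𝒱 : Finset (Set Y), IsFinOpenCover 𝒱 ∧ Refines 𝒱 𝒰 ∧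
      ∀ y : Y, (((𝒱.filter fun V => y ∈ V).card : ℕ∞)) ≤ n + 1}

/-- conversion of extended naturals into extended reals. -/
noncomputable def enatToEReal (n : ℕ∞) : EReal :=
  if n = ⊤ then ⊤ else ((n.toNat : ℝ) : EReal)

/-- The action of `G` on a `G`-invariant subset. -/
def invariantSubMulAction {G X : Type*} [Group G] [MulAction G X] (Y : Set X)
    (h : ∀ (s : G), ∀ x ∈ Y, s • x ∈ Y) : MulAction G Y where
  smul s y := ⟨s • (y : X), h s y y.2⟩
  one_smul y := Subtype.ext (one_smul G (y : X))
  mul_smul s t y := Subtype.ext (mul_smul s t (y : X))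

end SoficMD


open Filter Topology TopologicalSpace
open scoped ENat
open scoped Classical Pointwise

namespace SoficMD

section Shift

variable (G : Type*) [Group G] (Z : Type*)

/-- The left shift action of `G` on `Z^G`: `(s • x)_t = x_{s⁻¹ t}`. -/
instance shiftSMul : SMul G (G → Z) :=
  ⟨fun s x t => x (s⁻¹ * t)⟩

instance shiftMulAction : MulAction G (G → Z) where
  one_smul x := funext fun t => by
    show x (1⁻¹ * t) = x t
    rw [inv_one, one_mul]
  mul_smul s t x := funext fun u => by
    show x ((s * t)⁻¹ * u) = x (t⁻¹ * (s⁻¹ * u))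
    rw [mul_inv_rev, mul_assoc]

instance shiftContinuousConstSMul [TopologicalSpace Z] : ContinuousConstSMul G (G → Z) :=
  ⟨fun s => continuous_pi fun t => continuous_apply (s⁻¹ * t)⟩

end Shift

section Counting

theorem encard_le_sepNum {Y : Type*} {ρ : Y → Y → ℝ} {ε : ℝ} {E : Set Y}
    (hE : ∀ x ∈ E, ∀ y ∈ E, x ≠ y → ε ≤ ρ x y) : E.encard ≤ sepNum ρ ε :=
  le_iSup₂ (f := fun (E : Set Y) (_ : E ∈ {E : Set Y | ∀ x ∈ E, ∀ y ∈ E, x ≠ y → ε ≤ ρ x y}) =>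
    E.encard) E hE

theorem exists_encard_eq_sepNum {Y : Type*} {ρ : Y → Y → ℝ} {ε : ℝ} (h : sepNum ρ ε ≠ ⊤) :
    ∃ E : Set Y, (∀ x ∈ E, ∀ y ∈ E, x ≠ y → ε ≤ ρ x y) ∧ E.encard = sepNum ρ ε := by
  have heq : sepNum ρ ε = ⨆ E : {E : Set Y // ∀ x ∈ E, ∀ y ∈ E, x ≠ y → ε ≤ ρ x y},
      E.1.encard := by
    rw [sepNum, iSup_subtype]
    rfl
  have : Nonempty {E : Set Y // ∀ x ∈ E, ∀ y ∈ E, x ≠ y → ε ≤ ρ x y} := ⟨⟨∅, by simp⟩⟩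
  obtain ⟨E, hE⟩ := ENat.exists_eq_iSup_of_lt_top (heq ▸ lt_top_iff_ne_top.mpr h)
  exact ⟨E.1, E.2, hE.trans heq.symm⟩

/-- A map to a set `C` which separates points at distance at least `ε` bounds `sepNum`. -/
theorem sepNum_le_of_map {Y W : Type*} {ρ : Y → Y → ℝ} {ε : ℝ} {C : Set W} (g : Y → W)
    (hg : ∀ y, g y ∈ C) (hlt : ∀ x y, g x = g y → ρ x y < ε) : sepNum ρ ε ≤ C.encard := by
  refine iSup₂_le fun E hE => Set.encard_le_encard_of_injOn (f := g) (fun y _ => hg y) ?_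
  intro x hx y hy hxy
  by_contra hne
  exact (hlt x y hxy).not_ge (hE x hx y hy hne)

theorem sepNum_ne_zero {Y : Type*} [Nonempty Y] (ρ : Y → Y → ℝ) (ε : ℝ) : sepNum ρ ε ≠ 0 := by
  obtain ⟨y⟩ := ‹Nonempty Y›
  have h : ({y} : Set Y).encard ≤ sepNum ρ ε :=
    encard_le_sepNum fun a ha b hb hab => absurd (ha.trans hb.symm) hab
  rw [Set.encard_singleton] at h
  exact fun h0 => by simp [h0] at h

theorem sepNum_of_isEmpty {Y : Type*} [IsEmpty Y] (ρ : Y → Y → ℝ) (ε : ℝ) : sepNum ρ ε = 0 := by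
  simp [sepNum, Set.eq_empty_of_isEmpty]

theorem ContPseudoMetric.triangle_lt {Z : Type*} [TopologicalSpace Z] (ρ : ContPseudoMetric Z)
    {x y c : Z} {ε : ℝ} (hx : ρ.d x c < ε / 2) (hy : ρ.d y c < ε / 2) : ρ.d x y < ε := by
  have h := ρ.triangle x c y
  rw [ρ.symm c y] at h
  linarith

theorem ContPseudoMetric.sepNum_ne_top {Z : Type*} [TopologicalSpace Z] [CompactSpace Z]
    (ρ : ContPseudoMetric Z) {ε : ℝ} (hε : 0 < ε) : sepNum ρ.d ε ≠ ⊤ := by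
  obtain ⟨C, hC⟩ := isCompact_univ.elim_finite_subcover (fun c : Z => {x | ρ.d x c < ε / 2})
    (fun c => isOpen_lt (ρ.continuous'.comp (by fun_prop : Continuous fun x : Z => (x, c)))
      continuous_const)
    (fun x _ => Set.mem_iUnion.mpr ⟨x, by
      rw [Set.mem_ofPred_eq, ρ.refl]
      exact half_pos hε⟩)
  have hC' : ∀ x, ∃ c ∈ C, ρ.d x c < ε / 2 := fun x => by
    simpa using hC (Set.mem_univ x)
  choose g hg hlt using hC'
  refine ne_top_of_le_ne_top ?_ (sepNum_le_of_map (C := (C : Set Z)) g hg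
    fun x y hxy => ρ.triangle_lt (hlt x) (hxy ▸ hlt y))
  simp

/-- A maximal `ε`-separated set is `ε`-dense. -/
theorem ContPseudoMetric.exists_lt_of_encard_eq_sepNum {Z : Type*} [TopologicalSpace Z]
    (ρ : ContPseudoMetric Z) {ε : ℝ} (h : sepNum ρ.d ε ≠ ⊤) {E : Set Z}
    (hE : ∀ x ∈ E, ∀ y ∈ E, x ≠ y → ε ≤ ρ.d x y) (hcard : E.encard = sepNum ρ.d ε)
    (hε : 0 < ε) (z : Z) : ∃ c ∈ E, ρ.d z c < ε := by
  by_contra! hcon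
  have hz : z ∉ E := fun hz => (hcon z hz).not_gt (by rwa [ρ.refl])
  have hle : (insert z E).encard ≤ sepNum ρ.d ε := by
    refine encard_le_sepNum ?_
    rintro x (rfl | hx) y (rfl | hy) hxy
    · exact absurd rfl hxy
    · exact hcon y hy
    · rw [ρ.symm]
      exact hcon x hx
    · exact hE x hx y hy hxy
  rw [Set.encard_insert_of_notMem hz, hcard] at hle
  exact (ENat.lt_add_one_iff h).mpr le_rfl |>.not_ge hle

theorem elog_mono : Monotone elog := by
  intro m n hmn
  unfold elog
  by_cases hn : n = ⊤
  · simp [hn]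
  have hm : m ≠ ⊤ := ne_top_of_le_ne_top hn hmn
  by_cases hm0 : m = 0
  · simp [hm0]
  have hn0 : n ≠ 0 := fun h => hm0 (by simpa [h] using hmn)
  lift m to ℕ using hm
  lift n to ℕ using hn
  rw [if_neg (by simp), if_neg hm0, if_neg (by simp), if_neg hn0]
  have hmn' : m ≤ n := by exact_mod_cast hmn
  have hm0' : 0 < m := Nat.pos_of_ne_zero (by exact_mod_cast hm0)
  simp only [ENat.toNat_natCast, EReal.coe_le_coe_iff]
  gcongr

theorem elog_nonneg {n : ℕ∞} (hn : n ≠ 0) : 0 ≤ elog n := by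
  have h := elog_mono (Order.one_le_iff_ne_zero.mpr hn)
  simpa [elog] using h

theorem elog_pow_mul_inv {n : ℕ∞} (hn : n ≠ ⊤) {d : ℕ} (hd : d ≠ 0) :
    elog (n ^ d) * ((d : ℝ) : EReal)⁻¹ = elog n := by
  have hd' : (0 : ℝ) < d := by positivity
  rw [← EReal.coe_inv]
  lift n to ℕ using hn
  by_cases hn0 : n = 0
  · subst hn0
    simp only [elog, Nat.cast_zero, zero_pow hd]
    simpa using EReal.bot_mul_coe_of_pos (inv_pos.mpr hd')
  have hpow : ((n : ℕ∞) ^ d) = ((n ^ d : ℕ) : ℕ∞) := by push_cast; rfl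
  rw [hpow]
  simp only [elog, ENat.natCast_ne_top, if_false, Nat.cast_eq_zero, hn0, pow_eq_zero_iff hd,
    ENat.toNat_natCast]
  rw [← EReal.coe_mul, Nat.cast_pow, Real.log_pow]
  congr 1
  field_simp

theorem sepNum_le_pow {Z Y : Type*} [TopologicalSpace Z] (ρ : ContPseudoMetric Z) {ε : ℝ}
    (hε : 0 < ε) (h : sepNum ρ.d (ε / 2) ≠ ⊤) {d : ℕ} (hd : d ≠ 0) (g : Y → Fin d → Z) :
    sepNum (fun x y => ⨆ a, ρ.d (g x a) (g y a)) ε ≤ sepNum ρ.d (ε / 2) ^ d := by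
  obtain ⟨E, hE, hcard⟩ := exists_encard_eq_sepNum h
  choose c hc hlt using ρ.exists_lt_of_encard_eq_sepNum h hE hcard (half_pos hε)
  have hpow : (Set.univ.pi fun _ : Fin d => E).encard = sepNum ρ.d (ε / 2) ^ d := by
    rw [Set.encard_pi_eq_prod_encard]
    simp [hcard]
  rw [← hpow]
  refine sepNum_le_of_map (fun y a => c (g y a)) (fun y a _ => hc _) fun x y hxy => ?_
  have : Nonempty (Fin d) := ⟨⟨0, Nat.pos_of_ne_zero hd⟩⟩
  obtain ⟨a, ha⟩ := exists_eq_ciSup_of_finite (f := fun a => ρ.d (g x a) (g y a))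
  rw [← ha]
  have hca : c (g x a) = c (g y a) := congrFun hxy a
  exact ρ.triangle_lt (hlt _) (hca ▸ hlt _)

end Counting

section ShiftPseudoMetric

variable {G : Type*} [Group G] {Z : Type*} [TopologicalSpace Z]

/-- The pseudometric on `Z^G` comparing the coordinates at the identity. -/
def ContPseudoMetric.evalOne (G : Type*) [Group G] (ρ : ContPseudoMetric Z) :
    ContPseudoMetric (G → Z) where
  d x y := ρ.d (x 1) (y 1)
  continuous' := ρ.continuous'.comp
    (by fun_prop : Continuous fun p : (G → Z) × (G → Z) => (p.1 1, p.2 1))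
  nonneg _ _ := ρ.nonneg _ _
  symm _ _ := ρ.symm _ _
  refl _ := ρ.refl _
  triangle _ _ _ := ρ.triangle _ _ _

theorem ContPseudoMetric.dynGenerating_evalOne {ρ : ContPseudoMetric Z} (hρ : ρ.IsCompatMetric) :
    DynGenerating G (ρ.evalOne G) := by
  intro x y hxy
  obtain ⟨t, ht⟩ := Function.ne_iff.mp hxy
  refine ⟨t⁻¹, (ρ.nonneg _ _).lt_of_ne fun h => ht ?_⟩
  have h' := hρ _ _ h.symm
  simpa [show ∀ z : G → Z, (t⁻¹ • z) 1 = z (t⁻¹⁻¹ * 1) from fun _ => rfl] using h'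

/-- The approximately equivariant map `[d] → Z^G` built from a colouring `[d] → Z`. -/
def orbitMap {d : ℕ} (σ : G → Equiv.Perm (Fin d)) (f : Fin d → Z) : Fin d → G → Z :=
  fun a t => f (σ t⁻¹ a)

theorem ContPseudoMetric.exists_bound [CompactSpace Z] (ρ : ContPseudoMetric Z) :
    ∃ M, ∀ x y, ρ.d x y ≤ M := by
  obtain ⟨M, hM⟩ := isCompact_univ.bddAbove_image ρ.continuous'.continuousOn
  exact ⟨M, fun x y => hM ⟨(x, y), Set.mem_univ _, rfl⟩⟩

theorem rho2_orbitMap_sq_le (ρ : ContPseudoMetric Z) {M : ℝ} (hM : ∀ x y, ρ.d x y ≤ M) {d : ℕ}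
    (hd : d ≠ 0) (σ : G → Equiv.Perm (Fin d)) (s : G) (f : Fin d → Z) :
    rho2 (ρ.evalOne G) (fun a => orbitMap σ f (σ s a)) (fun a => s • orbitMap σ f a) ^ 2 ≤
      (1 - ((Finset.univ.filter fun a => σ 1 (σ s a) = σ (1 * s) a).card : ℝ) / d) * M ^ 2 := by
  have hd' : (0 : ℝ) < d := by positivity
  rw [rho2, Real.sq_sqrt (by positivity)]
  have hterm : ∀ a : Fin d, (ρ.evalOne G).d (orbitMap σ f (σ s a)) (s • orbitMap σ f a) =
      ρ.d (f (σ 1 (σ s a))) (f (σ s a)) := fun a => by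
    change ρ.d (f (σ 1⁻¹ (σ s a))) (f (σ (s⁻¹ * 1)⁻¹ a)) = _
    simp
  have hsum : ∑ a, ((ρ.evalOne G).d (orbitMap σ f (σ s a)) (s • orbitMap σ f a)) ^ 2 ≤
      ∑ a : Fin d, (1 - if σ 1 (σ s a) = σ (1 * s) a then 1 else 0) * M ^ 2 := by
    refine Finset.sum_le_sum fun a _ => ?_
    rw [hterm]
    split_ifs with h
    · rw [h, one_mul, ρ.refl]
      simp
    · have h0 := ρ.nonneg (f (σ 1 (σ s a))) (f (σ s a))
      simpa using pow_le_pow_left₀ h0 (hM _ _) 2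
  calc _ ≤ 1 / (d : ℝ) * ∑ a : Fin d, (1 - if σ 1 (σ s a) = σ (1 * s) a then 1 else 0) * M ^ 2 :=
        by gcongr
    _ = _ := by
      rw [← Finset.sum_mul, Finset.sum_sub_distrib, Finset.sum_boole]
      simp
      field_simp

theorem eventually_orbitMap_mem_mapSpace [CompactSpace Z] (Sap : SoficApprox G)
    (ρ : ContPseudoMetric Z) (F : Finset G) {δ : ℝ} (hδ : 0 < δ) :
    ∀ᶠ i in atTop, ∀ f : Fin (Sap.d i) → Z,
      orbitMap (Sap.σ i) f ∈ MapSpace (ρ.evalOne G) F δ (Sap.σ i) := by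
  obtain ⟨M, hM⟩ := ρ.exists_bound
  have hlim : ∀ s ∈ F, ∀ᶠ i in atTop,
      (1 - ((Finset.univ.filter fun a =>
        Sap.σ i 1 (Sap.σ i s a) = Sap.σ i (1 * s) a).card : ℝ) / Sap.d i) * M ^ 2 < δ ^ 2 := by
    intro s _
    have h := ((Sap.approx_mul 1 s).const_sub 1).mul_const (M ^ 2)
    rw [sub_self, zero_mul] at h
    exact h.eventually_lt_const (by positivity)
  filter_upwards [(Filter.eventually_all_finset F).mpr hlim, Sap.d_tendsto.eventually_ne_atTop 0]
    with i hi hd f s hs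
  exact le_of_sq_le_sq ((rho2_orbitMap_sq_le ρ hM hd (Sap.σ i) s f).trans (hi s hs).le) hδ.le

theorem pow_le_sepNum_mapSpace (ρ : ContPseudoMetric Z) {ε : ℝ} (h : sepNum ρ.d ε ≠ ⊤)
    {F : Finset G} {δ : ℝ} {d : ℕ} {σ : G → Equiv.Perm (Fin d)}
    (hσ : ∀ f : Fin d → Z, orbitMap σ f ∈ MapSpace (ρ.evalOne G) F δ σ) :
    sepNum ρ.d ε ^ d ≤
      sepNum (fun φ ψ : MapSpace (ρ.evalOne G) F δ σ => rhoInfty (ρ.evalOne G) φ.1 ψ.1) ε := by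
  obtain ⟨E, hE, hcard⟩ := exists_encard_eq_sepNum h
  have hpow : (Set.univ.pi fun _ : Fin d => E).encard = sepNum ρ.d ε ^ d := by
    rw [Set.encard_pi_eq_prod_encard]
    simp [hcard]
  have hone : ∀ f a, orbitMap σ f ((σ 1).symm a) 1 = (f : Fin d → Z) a := fun f a => by
    simp [orbitMap]
  let Φ : (Fin d → Z) → MapSpace (ρ.evalOne G) F δ σ := fun f => ⟨orbitMap σ f, hσ f⟩
  have hΦ : Function.Injective Φ := fun f g hfg => funext fun a => by
    rw [← hone f, ← hone g, show orbitMap σ f = orbitMap σ g from congrArg Subtype.val hfg]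
  rw [← hpow, ← hΦ.encard_image]
  refine encard_le_sepNum ?_
  rintro _ ⟨f, hf, rfl⟩ _ ⟨g, hg, rfl⟩ hfg
  obtain ⟨a, ha⟩ := Function.ne_iff.mp fun hfg' : f = g => hfg (congrArg Φ hfg')
  calc ε ≤ ρ.d (f a) (g a) := hE _ (hf a trivial) _ (hg a trivial) ha
    _ = (ρ.evalOne G).d (orbitMap σ f ((σ 1).symm a)) (orbitMap σ g ((σ 1).symm a)) := by
      rw [← hone f, ← hone g]
      rfl
    _ ≤ _ := le_ciSup (f := fun b => (ρ.evalOne G).d (orbitMap σ f b) (orbitMap σ g b))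
      (Set.finite_range _).bddAbove _

theorem sepNum_mapSpace_le_pow (ρ : ContPseudoMetric Z) {ε : ℝ} (hε : 0 < ε)
    (h : sepNum ρ.d (ε / 2) ≠ ⊤) {F : Finset G} {δ : ℝ} {d : ℕ} (hd : d ≠ 0)
    {σ : G → Equiv.Perm (Fin d)} :
    sepNum (fun φ ψ : MapSpace (ρ.evalOne G) F δ σ => rhoInfty (ρ.evalOne G) φ.1 ψ.1) ε ≤
      sepNum ρ.d (ε / 2) ^ d :=
  sepNum_le_pow ρ hε h hd fun (φ : MapSpace (ρ.evalOne G) F δ σ) a => φ.1 a 1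

theorem elog_sepNum_le_hEps [CompactSpace Z] (Sap : SoficApprox G) (ρ : ContPseudoMetric Z)
    {ε : ℝ} (hε : 0 < ε) : elog (sepNum ρ.d ε) ≤ hEps Sap (ρ.evalOne G) ε := by
  refine le_iInf fun F => le_iInf fun δ => ?_
  refine (limsup_const (f := atTop (α := ℕ)) (elog (sepNum ρ.d ε))).symm.trans_le
    (limsup_le_limsup ?_)
  filter_upwards [eventually_orbitMap_mem_mapSpace Sap ρ F.1 δ.2,
    Sap.d_tendsto.eventually_ne_atTop 0] with i hi hd
  rw [← elog_pow_mul_inv (ρ.sepNum_ne_top hε) hd]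
  refine mul_le_mul_of_nonneg_right
    (elog_mono (pow_le_sepNum_mapSpace ρ (ρ.sepNum_ne_top hε) hi)) ?_
  rw [← EReal.coe_inv]
  exact EReal.coe_nonneg.mpr (by positivity)

theorem hEps_le_elog_sepNum [CompactSpace Z] (Sap : SoficApprox G) (ρ : ContPseudoMetric Z)
    {ε : ℝ} (hε : 0 < ε) : hEps Sap (ρ.evalOne G) ε ≤ elog (sepNum ρ.d (ε / 2)) := by
  have htop := ρ.sepNum_ne_top (half_pos hε)
  refine iInf_le_of_le ⟨{1}, Finset.singleton_nonempty 1⟩ (iInf_le_of_le ⟨1, one_pos⟩ ?_)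
  refine (limsup_le_limsup ?_).trans_eq
    (limsup_const (f := atTop (α := ℕ)) (elog (sepNum ρ.d (ε / 2))))
  filter_upwards [Sap.d_tendsto.eventually_ne_atTop 0] with i hd
  rw [← elog_pow_mul_inv htop hd]
  refine mul_le_mul_of_nonneg_right (elog_mono (sepNum_mapSpace_le_pow ρ hε htop hd)) ?_
  rw [← EReal.coe_inv]
  exact EReal.coe_nonneg.mpr (by positivity)

end ShiftPseudoMetric

section Liminf

theorem tendsto_abs_log_half_div :
    Tendsto (fun ε : ℝ => |Real.log (2⁻¹ * ε)| * |Real.log ε|⁻¹) (𝓝[>] 0) (𝓝 1) := by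
  have h0 : Tendsto (fun ε : ℝ => (Real.log ε)⁻¹) (𝓝[>] 0) (𝓝 0) :=
    tendsto_inv_atBot_zero.comp Real.tendsto_log_nhdsGT_zero
  have h1 : Tendsto (fun ε : ℝ => |Real.log 2⁻¹ * (Real.log ε)⁻¹ + 1|) (𝓝[>] 0) (𝓝 1) := by
    simpa using ((h0.const_mul (Real.log 2⁻¹)).add_const 1).abs
  refine h1.congr' ?_
  filter_upwards [self_mem_nhdsWithin,
    Real.tendsto_log_nhdsGT_zero.eventually_ne_atBot 0] with ε hε hlog
  rw [← abs_inv, ← abs_mul, Real.log_mul (by norm_num) (ne_of_gt hε), add_mul,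
    mul_inv_cancel₀ hlog]

theorem liminf_half_mul_inv_abs_log_le {f : ℝ → EReal} (hf : ∀ ε, 0 ≤ f ε) :
    liminf (fun ε : ℝ => f (ε / 2) * ((|Real.log ε|⁻¹ : ℝ) : EReal)) (𝓝[>] (0 : ℝ)) ≤
      liminf (fun ε : ℝ => f ε * ((|Real.log ε|⁻¹ : ℝ) : EReal)) (𝓝[>] (0 : ℝ)) := by
  set g : ℝ → EReal := fun ε => f ε * ((|Real.log ε|⁻¹ : ℝ) : EReal) with hg
  set r : ℝ → EReal := fun ε => ((|Real.log (2⁻¹ * ε)| * |Real.log ε|⁻¹ : ℝ) : EReal) with hr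
  have hmap : map (fun ε : ℝ => 2⁻¹ * ε) (𝓝[>] 0) = 𝓝[>] 0 := by
    have h := (Homeomorph.mulLeft₀ (2⁻¹ : ℝ) (by norm_num)).isEmbedding.map_nhdsWithin_eq
      (Set.Ioi 0) 0
    simpa [Set.image_mul_left_Ioi] using h
  have hlim : limsup r (𝓝[>] 0) = 1 :=
    ((continuous_coe_real_ereal.tendsto 1).comp tendsto_abs_log_half_div).limsup_eq
  have hhalf : liminf (fun ε => g (2⁻¹ * ε)) (𝓝[>] 0) = liminf g (𝓝[>] 0) := by
    conv_rhs => rw [← hmap]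
    rfl
  have heq : (fun ε : ℝ => f (ε / 2) * ((|Real.log ε|⁻¹ : ℝ) : EReal)) =ᶠ[𝓝[>] 0]
      r * fun ε => g (2⁻¹ * ε) := by
    have hlog := Real.tendsto_log_nhdsGT_zero.eventually_ne_atBot 0
    rw [← hmap, eventually_map] at hlog
    filter_upwards [hlog] with ε hε
    rw [Pi.mul_apply, hg, hr]
    simp only
    rw [mul_left_comm, ← EReal.coe_mul, div_eq_inv_mul]
    rw [mul_right_comm, mul_inv_cancel₀ (abs_ne_zero.mpr hε), one_mul]
  rw [liminf_congr heq]
  refine (EReal.liminf_mul_le ?_ ?_ ?_ ?_).trans_eq ?_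
  · exact Eventually.of_forall fun ε => EReal.coe_nonneg.mpr (by positivity)
  · exact Eventually.of_forall fun ε => mul_nonneg (hf _) (EReal.coe_nonneg.mpr (by positivity))
  · exact Or.inl (by simp [hlim])
  · exact Or.inl (by simp [hlim]; exact EReal.coe_ne_top 1)
  · rw [hlim, one_mul, hhalf]

theorem liminf_elog_sepNum_half_le {Z : Type*} (ρ : Z → Z → ℝ) :
    liminf (fun ε : ℝ => elog (sepNum ρ (ε / 2)) * ((|Real.log ε|⁻¹ : ℝ) : EReal))
        (𝓝[>] (0 : ℝ)) ≤
      liminf (fun ε : ℝ => elog (sepNum ρ ε) * ((|Real.log ε|⁻¹ : ℝ) : EReal))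
        (𝓝[>] (0 : ℝ)) := by
  cases isEmpty_or_nonempty Z
  · simp only [sepNum_of_isEmpty, le_refl]
  · exact liminf_half_mul_inv_abs_log_le (f := fun ε => elog (sepNum ρ ε)) fun ε => elog_nonneg (sepNum_ne_zero ρ ε)

end Liminf

/-- For the left shift action of `G` on `X = Z^G` and a compatible metric `ρ` on
`Z`, the pseudometric `ρ'(x,y) = ρ(x_{e_G}, y_{e_G})` is a dynamically generating continuous
pseudometric on `X` satisfying `log N_ε(Z,ρ) ≤ h^ε_{Σ,∞}(ρ') ≤ log N_{ε/2}(Z,ρ)` for every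
`ε > 0`; in particular `mdim_{Σ,M}(X,ρ')` equals the lower box dimension of `(Z,ρ)`. -/
theorem shift_hEps_eq_boxDim {G : Type*} [Group G] [Countable G] (Sap : SoficApprox G)
    (Z : Type*) [TopologicalSpace Z] [CompactSpace Z] [MetrizableSpace Z]
    (ρ : ContPseudoMetric Z) (hρ : ρ.IsCompatMetric) :
    ∃ ρ' : ContPseudoMetric (G → Z),
      (∀ x y : G → Z, ρ'.d x y = ρ.d (x 1) (y 1)) ∧
      DynGenerating G ρ' ∧
      (∀ ε : ℝ, 0 < ε →
        elog (sepNum ρ.d ε) ≤ hEps Sap ρ' ε ∧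
        hEps Sap ρ' ε ≤ elog (sepNum ρ.d (ε / 2))) ∧
      mdimSigmaM Sap ρ' =
        liminf (fun ε : ℝ => elog (sepNum ρ.d ε) * ((|Real.log ε|⁻¹ : ℝ) : EReal))
          (𝓝[>] (0 : ℝ)) := by
  have hnonneg : ∀ ε : ℝ, (0 : EReal) ≤ ((|Real.log ε|⁻¹ : ℝ) : EReal) := fun ε =>
    EReal.coe_nonneg.mpr (by positivity)
  refine ⟨ρ.evalOne G, fun _ _ => rfl, ContPseudoMetric.dynGenerating_evalOne hρ,
    fun ε hε => ⟨elog_sepNum_le_hEps Sap ρ hε, hEps_le_elog_sepNum Sap ρ hε⟩, le_antisymm ?_ ?_⟩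
  · refine le_trans (liminf_le_liminf ?_) (liminf_elog_sepNum_half_le ρ.d)
    filter_upwards [self_mem_nhdsWithin] with ε hε
    exact mul_le_mul_of_nonneg_right (hEps_le_elog_sepNum Sap ρ hε) (hnonneg ε)
  · refine liminf_le_liminf ?_
    filter_upwards [self_mem_nhdsWithin] with ε hε
    exact mul_le_mul_of_nonneg_right (elog_sepNum_le_hEps Sap ρ hε) (hnonneg ε)

end SoficMD
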